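/- Let G = (V,E) be a hypergraph pointed at v, with edges containing v given by e_1 ⊂ e_2 ⊂ ⋯ ⊂ e_k, and define p_i := e_i \ {v} for all i ∈ [k]. Then the multilinear polytope MP_G is exactly the set of z ∈ ℝ^{V ∪ E} satisfying: z_u ≤ 1 for all u ∈ V; z_{e_k} ≥ 0; z_{e_k} ≤ z_{p_k}; z_{e_{i+1}} ≤ z_{e_i} for all i ∈ [k−1]; −z_{p_i} + z_{p_{i+1}} + z_{e_i} − z_{e_{i+1}} ≤ 0 for all i ∈ [k−1]; z_{p_{i+1}} ≤ z_u for all u ∈ e_{i+1} \ e_i and all i ∈ [k−1]; Σ_{u ∈ e_{i+1} \ e_i} z_u + z_{p_i} − z_{p_{i+1}} ≤ |e_{i+1} \ e_i| for all i ∈ [k−1]; z_{e_1} ≤ z_v; z_v + z_{p_1} − z_{e_1} ≤ 1; z_{p_1} ≤ z_u for all u ∈ p_1; and Σ_{u ∈ p_1} z_u − z_{p_1} ≤ |p_1| − 1. -/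

import Mathlib

open BigOperators

variable {α : Type*} [DecidableEq α]

/-- `(V, E)` forms a hypergraph: every edge is a subset of `V` of cardinality at least two. -/
def IsHypergraph (V : Finset α) (E : Finset (Finset α)) : Prop :=
  (∀ e ∈ E, e ⊆ V) ∧ ∀ e ∈ E, 2 ≤ e.card

/-- The multilinear set `S_G` of the hypergraph `G = (V, E)`, viewed inside the space of all
functions on node- and edge-coordinates, with all coordinates outside `V ∪ E` set to zero. -/
def mSet (V : Finset α) (E : Finset (Finset α)) : Set ((α ⊕ Finset α) → ℝ) :=
  { z | (∀ v ∈ V, z (Sum.inl v) = 0 ∨ z (Sum.inl v) = 1)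
      ∧ (∀ v, v ∉ V → z (Sum.inl v) = 0)
      ∧ (∀ e, e ∉ E → z (Sum.inr e) = 0)
      ∧ ∀ e ∈ E, z (Sum.inr e) = ∏ v ∈ e, z (Sum.inl v) }

/-- `S̄_H` for a hypergraph `H` with edge set `E₁`, inside the ambient space `{0,1}^{V ∪ E}`:
the binary points of the ambient hypergraph `(V, E)` whose restriction to the coordinates of
`H` lies in `S_H`. -/
def barSet (V : Finset α) (E E₁ : Finset (Finset α)) : Set ((α ⊕ Finset α) → ℝ) :=
  { z | (∀ v ∈ V, z (Sum.inl v) = 0 ∨ z (Sum.inl v) = 1)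
      ∧ (∀ e ∈ E, z (Sum.inr e) = 0 ∨ z (Sum.inr e) = 1)
      ∧ (∀ v, v ∉ V → z (Sum.inl v) = 0)
      ∧ (∀ e, e ∉ E → z (Sum.inr e) = 0)
      ∧ ∀ e ∈ E₁, z (Sum.inr e) = ∏ v ∈ e, z (Sum.inl v) }

/-- The variable `z_p`: the edge variable if `|p| ≥ 2`, the node variable `z_u` if `p = {u}`,
and `0` if `p = ∅`. -/
def zc (z : (α ⊕ Finset α) → ℝ) (p : Finset α) : ℝ :=
  if 2 ≤ p.card then z (Sum.inr p) else ∑ u ∈ p, z (Sum.inl u)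

/-- `v` is a nest point of `(V, E)`: the edges containing `v` are totally ordered by
inclusion. -/
def IsNestPoint (V : Finset α) (E : Finset (Finset α)) (v : α) : Prop :=
  v ∈ V ∧ ∀ e ∈ E, v ∈ e → ∀ f ∈ E, v ∈ f → e ⊆ f ∨ f ⊆ e

/-- Edge set of the hypergraph `G - v` obtained by removing the node `v`. -/
def eraseE (E : Finset (Finset α)) (v : α) : Finset (Finset α) :=
  (E.image fun e => e.erase v).filter fun p => 2 ≤ p.card

/-- Node set after removing a list of nodes. -/
def eraseListV (V : Finset α) (l : List α) : Finset α := l.foldl Finset.erase V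

/-- Edge set after removing a list of nodes. -/
def eraseListE (E : Finset (Finset α)) (l : List α) : Finset (Finset α) := l.foldl eraseE E

/-- `l` is a nest point sequence of `(V, E)`. -/
def IsNestPointSeq (V : Finset α) (E : Finset (Finset α)) (l : List α) : Prop :=
  l.Nodup ∧ ∀ i : Fin l.length,
    IsNestPoint (eraseListV V (l.take i.1)) (eraseListE E (l.take i.1)) (l.get i)

/-- `(V, E)` is expanded w.r.t. the sequence `l`. -/
def IsExpanded (V : Finset α) (E : Finset (Finset α)) (l : List α) : Prop :=
  IsNestPointSeq V E l ∧
    ∀ e ∈ E, ∀ i ≤ l.length, 2 ≤ (e \ (l.take i).toFinset).card →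
      e \ (l.take i).toFinset ∈ E

/-- Edge set of the expansion of `(V, E)` w.r.t. `l`. -/
def expansionE (E : Finset (Finset α)) (l : List α) : Finset (Finset α) :=
  E ∪ E.biUnion fun e =>
    ((Finset.range l.length).image fun i => e \ (l.take (i + 1)).toFinset).filter
      fun p => 2 ≤ p.card

/-- The hypergraph with edge set `E` contains a β-cycle (of length `t + 3 ≥ 3`). -/
def HasBetaCycle (E : Finset (Finset α)) : Prop :=
  ∃ t : ℕ, ∃ v : Fin (t + 3) → α, ∃ e : Fin (t + 3) → Finset α,
    Function.Injective v ∧ Function.Injective e ∧ (∀ i, e i ∈ E) ∧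
      ∀ i j : Fin (t + 3), v i ∈ e j ↔ (j = i ∨ j = i - 1)

/-- The hypergraph with edge set `E` is β-acyclic. -/
def IsBetaAcyclic (E : Finset (Finset α)) : Prop := ¬ HasBetaCycle E

/-- The product `a · z` over the coordinates indexed by `V ∪ E`. -/
def dotp (V : Finset α) (E : Finset (Finset α)) (a z : (α ⊕ Finset α) → ℝ) : ℝ :=
  (∑ u ∈ V, a (Sum.inl u) * z (Sum.inl u)) + ∑ f ∈ E, a (Sum.inr f) * z (Sum.inr f)

/-- The inequality `a · z ≤ b` is valid for the multilinear polytope of `(V, E)`. -/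
def IsValidIneq (V : Finset α) (E : Finset (Finset α)) (a : (α ⊕ Finset α) → ℝ)
    (b : ℝ) : Prop :=
  ∀ z ∈ convexHull ℝ (mSet V E), dotp V E a z ≤ b

/-- The inequality `a · z ≤ b` defines a facet of the multilinear polytope of `(V, E)`:
it is valid and the face it induces has affine dimension `|V| + |E| - 1`. -/
def IsFacetIneq (V : Finset α) (E : Finset (Finset α)) (a : (α ⊕ Finset α) → ℝ)
    (b : ℝ) : Prop :=
  IsValidIneq V E a b ∧
    Module.finrank ℝ
        (affineSpan ℝ {z ∈ convexHull ℝ (mSet V E) | dotp V E a z = b}).direction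
      = V.card + E.card - 1

/-- Restriction of a point to the coordinates indexed by `V' ∪ E'` (zero elsewhere). -/
def restrictTo (V' : Finset α) (E' : Finset (Finset α)) (z : (α ⊕ Finset α) → ℝ) :
    (α ⊕ Finset α) → ℝ
  | Sum.inl u => if u ∈ V' then z (Sum.inl u) else 0
  | Sum.inr f => if f ∈ E' then z (Sum.inr f) else 0

/-- The set `N(p_j) = p_j ∩ (⋃_{i < j} p_i)` induced by a running intersection ordering. -/
def Nfun {m : ℕ} (p : Fin m → Finset α) (j : Fin m) : Finset α :=
  p j ∩ (Finset.univ.filter fun i => i < j).biUnion p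

/-- The standard linearization `MP^LP` of `(V, E)` (with coordinates outside `V ∪ E` set to
zero). -/
def stdLin (V : Finset α) (E : Finset (Finset α)) : Set ((α ⊕ Finset α) → ℝ) :=
  { z | (∀ v, v ∉ V → z (Sum.inl v) = 0)
      ∧ (∀ e, e ∉ E → z (Sum.inr e) = 0)
      ∧ (∀ v ∈ V, z (Sum.inl v) ≤ 1)
      ∧ ∀ e ∈ E, 0 ≤ z (Sum.inr e)
          ∧ (∑ v ∈ e, z (Sum.inl v)) - (e.card : ℝ) + 1 ≤ z (Sum.inr e)
          ∧ ∀ v ∈ e, z (Sum.inr e) ≤ z (Sum.inl v) }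

/-- `S` is the half-space of an extended running intersection inequality of `(V, E)`. -/
def IsERIHalfspace (V : Finset α) (E : Finset (Finset α))
    (S : Set ((α ⊕ Finset α) → ℝ)) : Prop :=
  ∃ (t m : ℕ) (e₀ : Finset α) (eK : Fin t → Finset α) (p : Fin m → Finset α)
      (idx : Fin t → Fin m) (w : Fin t → Finset α),
    e₀ ∈ E ∧ (∀ k, eK k ∈ E) ∧ (∀ k, (e₀ ∩ eK k).Nonempty) ∧
      Function.Injective p ∧ (∀ j, ∃ k, p j = e₀ ∩ eK k) ∧
      (∀ k, p (idx k) = e₀ ∩ eK k) ∧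
      (∀ j : Fin m, 0 < (j : ℕ) → ∃ j' : Fin m, j' < j ∧ Nfun p j ⊆ p j') ∧
      (∀ k, w k ⊆ Nfun p (idx k) ∧ (w k = ∅ ∨ (∃ u ∈ V, w k = {u}) ∨ w k ∈ E)) ∧
      S = { z | - (∑ k : Fin t, zc z (w k))
            + (∑ u ∈ e₀ \ Finset.univ.biUnion eK, z (Sum.inl u))
            + (∑ k : Fin t, z (Sum.inr (eK k))) - z (Sum.inr e₀)
          ≤ ((e₀ \ Finset.univ.biUnion eK).card : ℝ)
            + ((Finset.univ.filter fun k : Fin t => Nfun p (idx k) = ∅).card : ℝ) - 1 }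

/-- The extended running intersection relaxation `MP^ERI` of `(V, E)`. -/
def MPERI (V : Finset α) (E : Finset (Finset α)) : Set ((α ⊕ Finset α) → ℝ) :=
  stdLin V E ∩ ⋂₀ { S | IsERIHalfspace V E S }

open MeasureTheory Set in
/-- A point whose coordinates are the probabilities of the events `C u` and of their
intersections along the edges lies in the multilinear polytope. -/
theorem mem_convexHull_mSet_of_measure {Ω : Type*} [MeasurableSpace Ω] (μ : Measure Ω)
    [IsProbabilityMeasure μ] {V : Finset α} {E : Finset (Finset α)} (hE : ∀ f ∈ E, f ⊆ V)
    (C : α → Set Ω) (hC : ∀ u ∈ V, MeasurableSet (C u)) (z : (α ⊕ Finset α) → ℝ)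
    (hV₀ : ∀ u, u ∉ V → z (Sum.inl u) = 0) (hE₀ : ∀ f, f ∉ E → z (Sum.inr f) = 0)
    (hzV : ∀ u ∈ V, z (Sum.inl u) = μ.real (C u))
    (hzE : ∀ f ∈ E, z (Sum.inr f) = μ.real (⋂ u ∈ f, C u)) :
    z ∈ convexHull ℝ (mSet V E) := by
  classical
  let pt : Finset α → (α ⊕ Finset α) → ℝ := fun s =>
    Sum.elim (fun u => if u ∈ s then 1 else 0) (fun f => if f ∈ E ∧ f ⊆ s then 1 else 0)
  let T : Finset α → Set Ω := fun s => ⋂ u ∈ V, {ω | ω ∈ C u ↔ u ∈ s}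
  have hTm : ∀ s, MeasurableSet (T s) := fun s =>
    Finset.measurableSet_biInter _ fun u hu => by
      by_cases h : u ∈ s
      · simpa [h] using hC u hu
      · have : {ω | ω ∈ C u ↔ u ∈ s} = (C u)ᶜ := by ext; simp [h]
        rw [this]
        exact (hC u hu).compl
  have key : ∀ f ⊆ V, μ.real (⋂ u ∈ f, C u) =
      ∑ s ∈ V.powerset, μ.real (T s) * (if f ⊆ s then 1 else 0) := by
    intro f hf
    have hU : (⋂ u ∈ f, C u) = ⋃ s ∈ V.powerset.filter (f ⊆ ·), T s := by
      ext ω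
      simp only [mem_iInter, mem_iUnion, Finset.mem_filter, Finset.mem_powerset, T,
        mem_ofPred_eq, exists_prop]
      constructor
      · intro h
        exact ⟨V.filter (ω ∈ C ·), ⟨Finset.filter_subset _ _, fun u hu => by
          simp [hf hu, h u hu]⟩, fun u hu => by simp [hu]⟩
      · rintro ⟨s, ⟨-, hfs⟩, hs⟩ u hu
        exact (hs u (hf hu)).2 (hfs hu)
    rw [hU, measureReal_biUnion_finset _ fun s _ => hTm s, Finset.sum_filter]
    · simp
    · intro s hs t ht hst
      simp only [Finset.coe_filter, Finset.mem_powerset, mem_ofPred_eq] at hs ht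
      refine Set.disjoint_left.2 fun ω h₁ h₂ => hst ?_
      simp only [T, mem_iInter, mem_ofPred_eq] at h₁ h₂
      ext u
      by_cases hu : u ∈ V
      · rw [← h₁ u hu, h₂ u hu]
      · exact ⟨fun h => (hu (hs.1 h)).elim, fun h => (hu (ht.1 h)).elim⟩
  have hz : z = ∑ s ∈ V.powerset, μ.real (T s) • pt s := by
    funext i
    simp only [Finset.sum_apply, Pi.smul_apply, smul_eq_mul]
    rcases i with u | f
    · by_cases hu : u ∈ V
      · have := key {u} (by simpa using hu)
        simp only [Finset.mem_singleton, iInter_iInter_eq_left, Finset.singleton_subset_iff] at this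
        rw [hzV u hu, this]
        rfl
      · rw [hV₀ u hu, eq_comm]
        refine Finset.sum_eq_zero fun s hs => ?_
        have : u ∉ s := fun h => hu (Finset.mem_powerset.1 hs h)
        simp [pt, this]
    · by_cases hf : f ∈ E
      · rw [hzE f hf, key f (hE f hf)]
        simp [pt, hf]
      · simp [hE₀ f hf, pt, hf]
  rw [hz]
  refine (convex_convexHull ℝ _).sum_mem (fun _ _ => measureReal_nonneg) ?_ fun s hs => ?_
  · have := key ∅ (by simp)
    simpa using this.symm
  · refine subset_convexHull ℝ _ ⟨fun u _ => ?_, fun u hu => ?_, fun f hf => ?_, fun f hf => ?_⟩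
    · by_cases h : u ∈ s <;> simp [pt, h]
    · have : u ∉ s := fun h => hu (Finset.mem_powerset.1 hs h)
      simp [pt, this]
    · simp [pt, hf]
    · simp only [pt, Sum.elim_inr, Sum.elim_inl, hf, true_and]
      rw [Finset.prod_ite_zero]
      simp [Finset.subset_iff]

open MeasureTheory Set in
/-- Between two nested measurable subsets of a bounded interval there are measurable sets of
every intermediate length. -/
theorem exists_measurableSet_between_volume_eq {p q c : ℝ} {X Y : Set ℝ} (hX : MeasurableSet X)
    (hY : MeasurableSet Y) (hXY : X ⊆ Y) (hYpq : Y ⊆ Ico p q)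
    (hXc : volume.real X ≤ c) (hcY : c ≤ volume.real Y) :
    ∃ N, MeasurableSet N ∧ X ⊆ N ∧ N ⊆ Y ∧ volume.real N = c := by
  have hfin : ∀ Z ⊆ Y, volume Z ≠ ⊤ := fun Z hZ =>
    ((measure_mono (hZ.trans hYpq)).trans_lt measure_Ico_lt_top).ne
  have hsub : ∀ t, X ∪ Y ∩ Iic t ⊆ Y := fun t => union_subset hXY inter_subset_left
  let G : ℝ → ℝ := fun t => volume.real (X ∪ Y ∩ Iic t)
  have hmono : Monotone G := fun s t hst =>
    measureReal_mono (union_subset_union_right _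
      (inter_subset_inter_right _ (Iic_subset_Iic.2 hst))) (hfin _ (hsub t))
  have hG : ∀ s t, s ≤ t → G t ≤ G s + (t - s) := by
    intro s t hst
    have h₁ : X ∪ Y ∩ Iic t ⊆ (X ∪ Y ∩ Iic s) ∪ Ioc s t := by
      rintro x (hx | ⟨hx, hxt⟩)
      · exact Or.inl (Or.inl hx)
      · rcases le_or_gt x s with h | h
        · exact Or.inl (Or.inr ⟨hx, h⟩)
        · exact Or.inr ⟨h, hxt⟩
    calc G t ≤ volume.real ((X ∪ Y ∩ Iic s) ∪ Ioc s t) :=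
          measureReal_mono h₁ (measure_union_ne_top (hfin _ (hsub s)) measure_Ioc_lt_top.ne)
      _ ≤ G s + volume.real (Ioc s t) := measureReal_union_le _ _
      _ = G s + (t - s) := by rw [Real.volume_real_Ioc_of_le hst]
  have hcont : Continuous G := by
    refine (LipschitzWith.of_le_add (f := G) fun s t => ?_).continuous
    rw [Real.dist_eq]
    rcases le_total t s with h | h
    · exact (hG t s h).trans (by gcongr; exact le_abs_self _)
    · exact (hmono h).trans (by linarith [abs_nonneg (s - t)])
  have hp : G (min p q - 1) = volume.real X := by
    have : Y ∩ Iic (min p q - 1) = ∅ := by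
      refine eq_empty_of_forall_notMem fun x hx => ?_
      have h₁ := (hYpq hx.1).1
      have h₂ : x ≤ min p q - 1 := hx.2
      linarith [min_le_left p q]
    simp [G, this]
  have hq : G q = volume.real Y := by
    have : Y ∩ Iic q = Y := inter_eq_left.2 fun x hx => (hYpq hx).2.le
    simp [G, this, union_eq_right.2 hXY]
  obtain ⟨t, -, ht⟩ := intermediate_value_Icc (a := min p q - 1) (b := q)
    (by linarith [min_le_right p q]) hcont.continuousOn
    (show c ∈ Icc _ _ by rw [hp, hq]; exact ⟨hXc, hcY⟩)
  exact ⟨_, hX.union (hY.inter measurableSet_Iic), subset_union_left, hsub t, ht⟩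

open MeasureTheory Set in
/-- A set `X` contained in `Y` can be covered by subsets of `Y` of prescribed lengths as soon as
these lengths sum up to at least the length of `X`. -/
theorem exists_cover_volume_eq {p q : ℝ} {Y : Set ℝ} (hY : MeasurableSet Y)
    (hYpq : Y ⊆ Ico p q) (c : α → ℝ) {D : Finset α} (hD : D.Nonempty)
    (hc₀ : ∀ u ∈ D, 0 ≤ c u) (hcY : ∀ u ∈ D, c u ≤ volume.real Y) {X : Set ℝ}
    (hX : MeasurableSet X) (hXY : X ⊆ Y) (hXc : volume.real X ≤ ∑ u ∈ D, c u) :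
    ∃ N : α → Set ℝ, (∀ u ∈ D, MeasurableSet (N u) ∧ N u ⊆ Y ∧ volume.real (N u) = c u) ∧
      X ⊆ ⋃ u ∈ D, N u := by
  induction hD using Finset.Nonempty.cons_induction generalizing X with
  | singleton a =>
    obtain ⟨N, hN, hXN, hNY, hNc⟩ := exists_measurableSet_between_volume_eq hX hY hXY hYpq
      (by simpa using hXc) (hcY a (by simp))
    exact ⟨fun _ => N, by simp [hN, hNY, hNc], by simpa using hXN⟩
  | cons a D ha hD ih =>
    simp only [Finset.mem_cons, forall_eq_or_imp] at hc₀ hcY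
    rw [Finset.sum_cons] at hXc
    obtain ⟨N₀, hN₀, hN₀Y, hN₀c, hX₀⟩ : ∃ N₀, MeasurableSet N₀ ∧ N₀ ⊆ Y ∧
        volume.real N₀ = c a ∧ volume.real (X \ N₀) ≤ ∑ u ∈ D, c u := by
      rcases le_total (volume.real X) (c a) with h | h
      · obtain ⟨N, hN, hXN, hNY, hNc⟩ :=
          exists_measurableSet_between_volume_eq hX hY hXY hYpq h hcY.1
        refine ⟨N, hN, hNY, hNc, ?_⟩
        rw [sdiff_eq_empty.2 hXN]
        simpa using Finset.sum_nonneg hc₀.2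
      · obtain ⟨N, hN, -, hNX, hNc⟩ := exists_measurableSet_between_volume_eq
          MeasurableSet.empty hX (empty_subset X) (hXY.trans hYpq) (by simpa using hc₀.1) h
        refine ⟨N, hN, hNX.trans hXY, hNc, ?_⟩
        rw [measureReal_sdiff hNX hN
          ((measure_mono (hXY.trans hYpq)).trans_lt measure_Ico_lt_top).ne]
        linarith
    obtain ⟨N, hN, hcov⟩ := ih hc₀.2 hcY.2 (hX.diff hN₀) (sdiff_subset.trans hXY) hX₀
    have hne : ∀ u ∈ D, u ≠ a := fun u hu h => ha (h ▸ hu)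
    refine ⟨Function.update N a N₀, ?_, fun x hx => ?_⟩
    · simp only [Finset.mem_cons, forall_eq_or_imp, Function.update_self]
      refine ⟨⟨hN₀, hN₀Y, hN₀c⟩, fun u hu => ?_⟩
      rw [Function.update_of_ne (hne u hu)]
      exact hN u hu
    · by_cases h : x ∈ N₀
      · exact mem_biUnion (x := a) (by simp) (by simpa using h)
      · obtain ⟨u, hu, hxu⟩ := mem_iUnion₂.1 (hcov ⟨hx, h⟩)
        refine mem_biUnion (x := u) (by simp [hu]) ?_
        rwa [Function.update_of_ne (hne u hu)]

open MeasureTheory Set in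
/-- A decreasing sequence of events `A i` in an interval of length one can be realized as the
intersections of events `C u` with prescribed probabilities along an increasing sequence of
finite sets `P i`. -/
theorem exists_events_of_chain {p q : ℝ} (hpq : q = p + 1) (c : α → ℝ) (P : ℕ → Finset α)
    (A : ℕ → Set ℝ) (n : ℕ) (hP₀ : P 0 = ∅) (hA₀ : A 0 = Ico p q)
    (hA : ∀ i ≤ n, MeasurableSet (A i)) (hP : ∀ i < n, P i ⊂ P (i + 1))
    (hAmono : ∀ i < n, A (i + 1) ⊆ A i)
    (hc₁ : ∀ i < n, ∀ u ∈ P (i + 1), c u ≤ 1)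
    (hAc : ∀ i < n, ∀ u ∈ P (i + 1) \ P i, volume.real (A (i + 1)) ≤ c u)
    (hsum : ∀ i < n, volume.real (A i) - volume.real (A (i + 1)) ≤
      ∑ u ∈ P (i + 1) \ P i, (1 - c u)) :
    ∃ C : α → Set ℝ, (∀ u ∈ P n, MeasurableSet (C u) ∧ C u ⊆ Ico p q ∧
      volume.real (C u) = c u) ∧
      ∀ i ≤ n, ∀ ω ∈ Ico p q, ω ∈ A i ↔ ∀ u ∈ P i, ω ∈ C u := by
  have hvol : volume.real (Ico p q) = 1 := by
    rw [Real.volume_real_Ico_of_le (by linarith)]; linarith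
  have hfin : ∀ Z ⊆ Ico p q, volume Z ≠ ⊤ := fun Z hZ =>
    ((measure_mono hZ).trans_lt measure_Ico_lt_top).ne
  induction n with
  | zero =>
    refine ⟨fun _ => ∅, by simp [hP₀], fun i hi ω hω => ?_⟩
    obtain rfl : i = 0 := by omega
    simp only [hA₀, hP₀]
    simpa using hω
  | succ n ih =>
    obtain ⟨C, hC, hCA⟩ := ih (fun i hi => hA i (by omega)) (fun i hi => hP i (by omega))
      (fun i hi => hAmono i (by omega)) (fun i hi => hc₁ i (by omega))
      (fun i hi => hAc i (by omega)) (fun i hi => hsum i (by omega))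
    have hAsub : ∀ i ≤ n + 1, A i ⊆ Ico p q := by
      intro i hi
      induction i with
      | zero => rw [hA₀]
      | succ i ih' => exact (hAmono i (by omega)).trans (ih' (by omega))
    have hPsub : ∀ i ≤ n, P i ⊆ P n := by
      suffices ∀ m ≤ n, ∀ i ≤ m, P i ⊆ P m from this n le_rfl
      intro m hm i hi
      induction m, hi using Nat.le_induction with
      | base => rfl
      | succ m _ ih' => exact (ih' (by omega)).trans (hP m (by omega)).1
    have hA' := hAsub (n + 1) le_rfl
    have hm := hA (n + 1) le_rfl
    obtain ⟨N, hN, hcov⟩ := exists_cover_volume_eq (p := p) (q := q)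
      (Y := Ico p q \ A (n + 1)) (measurableSet_Ico.diff hm) sdiff_subset (fun u => 1 - c u)
      (D := P (n + 1) \ P n) (Finset.sdiff_nonempty.2 (hP n (by omega)).2)
      (fun u hu => by
        have := hc₁ n (by omega) u (Finset.mem_sdiff.1 hu).1
        linarith)
      (fun u hu => by
        rw [measureReal_sdiff hA' hm (hfin _ subset_rfl), hvol]
        linarith [hAc n (by omega) u hu])
      (X := A n \ A (n + 1)) ((hA n (by omega)).diff hm)
      (sdiff_subset_sdiff_left (hAsub n (by omega)))
      (by
        rw [measureReal_sdiff (hAmono n (by omega)) hm (hfin _ (hAsub n (by omega)))]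
        exact hsum n (by omega))
    refine ⟨fun u => if u ∈ P n then C u else Ico p q \ N u, fun u hu => ?_,
      fun i hi ω hω => ?_⟩
    · by_cases h : u ∈ P n
      · simpa only [h, if_true] using hC u h
      · obtain ⟨h₁, h₂, h₃⟩ := hN u (Finset.mem_sdiff.2 ⟨hu, h⟩)
        simp only [h, if_false]
        refine ⟨measurableSet_Ico.diff h₁, sdiff_subset, ?_⟩
        rw [measureReal_sdiff (h₂.trans sdiff_subset) h₁ (hfin _ subset_rfl), hvol, h₃]
        ring
    · have hlow : ∀ j ≤ n, (ω ∈ A j ↔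
          ∀ u ∈ P j, ω ∈ if u ∈ P n then C u else Ico p q \ N u) := by
        intro j hj
        rw [hCA j hj ω hω]
        exact forall₂_congr fun u hu => by rw [if_pos (hPsub j hj hu)]
      rcases Nat.lt_or_ge i (n + 1) with hi' | hi'
      · exact hlow i (by omega)
      · obtain rfl : i = n + 1 := by omega
        constructor
        · intro h u hu
          by_cases hun : u ∈ P n
          · exact (hlow n le_rfl).1 (hAmono n (by omega) h) u hun
          · simp only [if_neg hun]
            exact ⟨hω, fun h' => ((hN u (Finset.mem_sdiff.2 ⟨hu, hun⟩)).2.1 h').2 h⟩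
        · intro h
          have hn : ω ∈ A n := (hlow n le_rfl).2 fun u hu => h u ((hP n (by omega)).1 hu)
          by_contra hω'
          obtain ⟨u, hu, hωu⟩ := mem_iUnion₂.1 (hcov ⟨hn, hω'⟩)
          have := h u (Finset.mem_sdiff.1 hu).1
          simp only [if_neg (Finset.mem_sdiff.1 hu).2] at this
          exact this.2 hωu

theorem zc_add (x y : (α ⊕ Finset α) → ℝ) (p : Finset α) : zc (x + y) p = zc x p + zc y p := by
  unfold zc
  split_ifs <;> simp [Finset.sum_add_distrib]

theorem zc_smul (r : ℝ) (x : (α ⊕ Finset α) → ℝ) (p : Finset α) :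
    zc (r • x) p = r * zc x p := by
  unfold zc
  split_ifs <;> simp [Finset.mul_sum]

theorem zc_singleton (x : (α ⊕ Finset α) → ℝ) (u : α) : zc x {u} = x (Sum.inl u) := by
  simp [zc]

/-- On the multilinear set, `zc` is the monomial of its index set. -/
theorem zc_eq_prod {V : Finset α} {E : Finset (Finset α)} {x : (α ⊕ Finset α) → ℝ}
    (hx : x ∈ mSet V E) {p : Finset α} (hp : p.Nonempty) (hpE : 2 ≤ p.card → p ∈ E) :
    zc x p = ∏ u ∈ p, x (Sum.inl u) := by
  by_cases h : 2 ≤ p.card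
  · rw [zc, if_pos h, hx.2.2.2 p (hpE h)]
  · obtain ⟨u, rfl⟩ := Finset.card_eq_one.1
      (le_antisymm (by omega) (Finset.card_pos.2 hp) : p.card = 1)
    rw [zc_singleton, Finset.prod_singleton]

theorem one_sub_prod_le_sum_one_sub {s : Finset α} {x : α → ℝ} (h₀ : ∀ u ∈ s, 0 ≤ x u)
    (h₁ : ∀ u ∈ s, x u ≤ 1) : 1 - ∏ u ∈ s, x u ≤ ∑ u ∈ s, (1 - x u) := by
  induction s using Finset.cons_induction with
  | empty => simp
  | cons a s ha ih =>
    simp only [Finset.mem_cons, forall_eq_or_imp] at h₀ h₁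
    rw [Finset.prod_cons, Finset.sum_cons]
    nlinarith [ih h₀.2 h₁.2, Finset.prod_le_one h₀.2 h₁.2]

theorem prod_le_of_mem {s : Finset α} {x : α → ℝ} (h₀ : ∀ u ∈ s, 0 ≤ x u)
    (h₁ : ∀ u ∈ s, x u ≤ 1) {u : α} (hu : u ∈ s) : ∏ u ∈ s, x u ≤ x u := by
  rw [← Finset.mul_prod_erase s x hu]
  exact mul_le_of_le_one_right (h₀ u hu) (Finset.prod_le_one
    (fun i hi => h₀ i (Finset.mem_of_mem_erase hi)) fun i hi => h₁ i (Finset.mem_of_mem_erase hi))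

theorem erase_sdiff_erase_of_mem {s t : Finset α} {v : α} (hv : v ∈ t) :
    s.erase v \ t.erase v = s \ t := by
  ext u
  by_cases h : u = v <;> simp [h, hv]

theorem le_of_mem_convexHull {M : Type*} [AddCommGroup M] [Module ℝ M] {S : Set M} {z : M}
    (hz : z ∈ convexHull ℝ S) (f : M →ₗ[ℝ] ℝ) {c : ℝ} (h : ∀ x ∈ S, f x ≤ c) : f z ≤ c :=
  convexHull_min (t := {w | f w ≤ c}) h (convex_halfSpace_le f.isLinear c) hz

/-- The linear inequalities describing the multilinear polytope of a hypergraph pointed at `v`,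
whose edges containing `v` are `e 0 ⊂ ⋯ ⊂ e (k - 1)`. -/
def pointedPolytope (V : Finset α) (E : Finset (Finset α)) (v : α) (k : ℕ)
    (e : ℕ → Finset α) : Set ((α ⊕ Finset α) → ℝ) :=
  { z | (∀ u, u ∉ V → z (Sum.inl u) = 0)
      ∧ (∀ f, f ∉ E → z (Sum.inr f) = 0)
      ∧ (∀ u ∈ V, z (Sum.inl u) ≤ 1)
      ∧ 0 ≤ z (Sum.inr (e (k - 1)))
      ∧ z (Sum.inr (e (k - 1))) ≤ zc z ((e (k - 1)).erase v)
      ∧ (∀ i : ℕ, i + 1 < k → z (Sum.inr (e (i + 1))) ≤ z (Sum.inr (e i)))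
      ∧ (∀ i : ℕ, i + 1 < k →
          - zc z ((e i).erase v) + zc z ((e (i + 1)).erase v)
            + z (Sum.inr (e i)) - z (Sum.inr (e (i + 1))) ≤ 0)
      ∧ (∀ i : ℕ, i + 1 < k → ∀ u ∈ e (i + 1) \ e i,
          zc z ((e (i + 1)).erase v) ≤ z (Sum.inl u))
      ∧ (∀ i : ℕ, i + 1 < k →
          (∑ u ∈ e (i + 1) \ e i, z (Sum.inl u))
            + zc z ((e i).erase v) - zc z ((e (i + 1)).erase v)
            ≤ ((e (i + 1) \ e i).card : ℝ))
      ∧ z (Sum.inr (e 0)) ≤ z (Sum.inl v)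
      ∧ z (Sum.inl v) + zc z ((e 0).erase v) - z (Sum.inr (e 0)) ≤ 1
      ∧ (∀ u ∈ (e 0).erase v, zc z ((e 0).erase v) ≤ z (Sum.inl u))
      ∧ (∑ u ∈ (e 0).erase v, z (Sum.inl u)) - zc z ((e 0).erase v)
          ≤ (((e 0).erase v).card : ℝ) - 1 }

theorem convexHull_mSet_subset_pointedPolytope {V : Finset α} {E : Finset (Finset α)}
    {v : α} {k : ℕ} (hk : 1 ≤ k) {e : ℕ → Finset α} (hE : ∀ f ∈ E, f ⊆ V)
    (hchain : ∀ i, i + 1 < k → e i ⊂ e (i + 1)) (hv : ∀ i < k, v ∈ e i)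
    (hcard : ∀ i < k, 2 ≤ (e i).card) (heE : ∀ i < k, e i ∈ E)
    (hpE : ∀ i < k, 2 ≤ ((e i).erase v).card → (e i).erase v ∈ E) :
    convexHull ℝ (mSet V E) ⊆ pointedPolytope V E v k e := by
  intro z hz
  let X : α → ((α ⊕ Finset α) → ℝ) →ₗ[ℝ] ℝ := fun u => LinearMap.proj (Sum.inl u)
  let Y : Finset α → ((α ⊕ Finset α) → ℝ) →ₗ[ℝ] ℝ := fun f => LinearMap.proj (Sum.inr f)
  let Z : Finset α → ((α ⊕ Finset α) → ℝ) →ₗ[ℝ] ℝ := fun p =>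
    IsLinearMap.mk' (fun x => zc x p) ⟨fun x y => zc_add x y p, fun r x => zc_smul r x p⟩
  let W : Finset α → ((α ⊕ Finset α) → ℝ) →ₗ[ℝ] ℝ := fun s =>
    IsLinearMap.mk' (fun x => ∑ u ∈ s, x (Sum.inl u))
      ⟨fun x y => by simp [Finset.sum_add_distrib], fun r x => by simp [Finset.mul_sum]⟩
  have hlast : k - 1 < k := by omega
  have hpV : ∀ i < k, (e i).erase v ⊆ V := fun i hi =>
    (Finset.erase_subset _ _).trans (hE _ (heE i hi))
  have hvV : v ∈ V := hE _ (heE 0 hk) (hv 0 hk)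
  have hx₀ : ∀ x ∈ mSet V E, ∀ u ∈ V, 0 ≤ x (Sum.inl u) := fun x hx u hu => by
    rcases hx.1 u hu with h | h <;> simp [h]
  have hx₁ : ∀ x ∈ mSet V E, ∀ u ∈ V, x (Sum.inl u) ≤ 1 := fun x hx u hu => by
    rcases hx.1 u hu with h | h <;> simp [h]
  have hπ₀ : ∀ x ∈ mSet V E, ∀ s ⊆ V, 0 ≤ ∏ u ∈ s, x (Sum.inl u) := fun x hx s hs =>
    Finset.prod_nonneg fun u hu => hx₀ x hx u (hs hu)
  have hπ₁ : ∀ x ∈ mSet V E, ∀ s ⊆ V, ∏ u ∈ s, x (Sum.inl u) ≤ 1 := fun x hx s hs =>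
    Finset.prod_le_one (fun u hu => hx₀ x hx u (hs hu)) fun u hu => hx₁ x hx u (hs hu)
  have hzc : ∀ x ∈ mSet V E, ∀ i < k,
      zc x ((e i).erase v) = ∏ u ∈ (e i).erase v, x (Sum.inl u) := fun x hx i hi =>
    zc_eq_prod hx (Finset.card_pos.1 (by
      have := hcard i hi
      rw [Finset.card_erase_of_mem (hv i hi)]
      omega)) (hpE i hi)
  have hze : ∀ x ∈ mSet V E, ∀ i < k, x (Sum.inr (e i)) =
      x (Sum.inl v) * ∏ u ∈ (e i).erase v, x (Sum.inl u) := fun x hx i hi => by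
    rw [hx.2.2.2 _ (heE i hi), Finset.mul_prod_erase (e i) (fun u => x (Sum.inl u)) (hv i hi)]
  have hstep : ∀ x : (α ⊕ Finset α) → ℝ, ∀ i, i + 1 < k →
      ∏ u ∈ (e (i + 1)).erase v, x (Sum.inl u) =
        (∏ u ∈ e (i + 1) \ e i, x (Sum.inl u)) * ∏ u ∈ (e i).erase v, x (Sum.inl u) := by
    intro x i hi
    rw [← erase_sdiff_erase_of_mem (hv i (by omega)),
      Finset.prod_sdiff (Finset.erase_subset_erase v (hchain i hi).1)]
  have hDV : ∀ i, i + 1 < k → e (i + 1) \ e i ⊆ V := fun i hi =>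
    Finset.sdiff_subset.trans (hE _ (heE _ hi))
  refine ⟨fun u hu => ?_, fun f hf => ?_, fun u hu => ?_, ?_, ?_, fun i hi => ?_, fun i hi => ?_,
    fun i hi u hu => ?_, fun i hi => ?_, ?_, ?_, fun u hu => ?_, ?_⟩
  · have h₁ := le_of_mem_convexHull hz (X u) (c := 0) fun x hx => (hx.2.1 u hu).le
    have h₂ := le_of_mem_convexHull hz (-X u) (c := 0) fun x hx =>
      (neg_eq_zero.2 (hx.2.1 u hu)).le
    exact le_antisymm h₁ (neg_nonpos.1 h₂)
  · have h₁ := le_of_mem_convexHull hz (Y f) (c := 0) fun x hx => (hx.2.2.1 f hf).le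
    have h₂ := le_of_mem_convexHull hz (-Y f) (c := 0) fun x hx =>
      (neg_eq_zero.2 (hx.2.2.1 f hf)).le
    exact le_antisymm h₁ (neg_nonpos.1 h₂)
  · exact le_of_mem_convexHull hz (X u) fun x hx => hx₁ x hx u hu
  · refine neg_nonpos.1 (le_of_mem_convexHull hz (-Y (e (k - 1))) (c := 0) fun x hx => ?_)
    change -x (Sum.inr _) ≤ 0
    rw [hze x hx _ hlast]
    exact neg_nonpos.2 (mul_nonneg (hx₀ x hx v hvV) (hπ₀ x hx _ (hpV _ hlast)))
  · refine sub_nonpos.1 (le_of_mem_convexHull hz (Y (e (k - 1)) - Z ((e (k - 1)).erase v))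
      (c := 0) fun x hx => ?_)
    change x (Sum.inr _) - zc x _ ≤ 0
    rw [hze x hx _ hlast, hzc x hx _ hlast]
    nlinarith [hx₁ x hx v hvV, hπ₀ x hx _ (hpV _ hlast)]
  · refine sub_nonpos.1 (le_of_mem_convexHull hz (Y (e (i + 1)) - Y (e i))
      (c := 0) fun x hx => ?_)
    change x (Sum.inr _) - x (Sum.inr _) ≤ 0
    rw [hze x hx _ hi, hze x hx i (by omega), hstep x i hi]
    nlinarith [mul_nonneg (hx₀ x hx v hvV) (hπ₀ x hx _ (hpV i (by omega))),
      hπ₁ x hx _ (hDV i hi)]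
  · refine le_of_mem_convexHull hz (-Z ((e i).erase v) + Z ((e (i + 1)).erase v)
      + Y (e i) - Y (e (i + 1))) (c := 0) fun x hx => ?_
    change -zc x _ + zc x _ + x (Sum.inr _) - x (Sum.inr _) ≤ 0
    rw [hze x hx _ hi, hze x hx i (by omega), hzc x hx _ hi, hzc x hx i (by omega), hstep x i hi]
    nlinarith [mul_nonneg (mul_nonneg (sub_nonneg.2 (hx₁ x hx v hvV))
      (hπ₀ x hx _ (hpV i (by omega)))) (sub_nonneg.2 (hπ₁ x hx _ (hDV i hi)))]
  · refine sub_nonpos.1 (le_of_mem_convexHull hz (Z ((e (i + 1)).erase v) - X u)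
      (c := 0) fun x hx => ?_)
    change zc x _ - x (Sum.inl u) ≤ 0
    rw [hzc x hx _ hi]
    refine sub_nonpos.2 (prod_le_of_mem (fun w hw => hx₀ x hx w (hpV _ hi hw))
      (fun w hw => hx₁ x hx w (hpV _ hi hw)) ?_)
    rw [← erase_sdiff_erase_of_mem (hv i (by omega))] at hu
    exact (Finset.mem_sdiff.1 hu).1
  · refine le_of_mem_convexHull hz (W (e (i + 1) \ e i) + Z ((e i).erase v)
      - Z ((e (i + 1)).erase v)) fun x hx => ?_
    change ∑ u ∈ _, x (Sum.inl u) + zc x _ - zc x _ ≤ _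
    rw [hzc x hx _ hi, hzc x hx i (by omega), hstep x i hi]
    have := one_sub_prod_le_sum_one_sub (fun u hu => hx₀ x hx u (hDV i hi hu))
      fun u hu => hx₁ x hx u (hDV i hi hu)
    rw [Finset.sum_sub_distrib, Finset.sum_const, nsmul_one] at this
    nlinarith [hπ₁ x hx _ (hpV i (by omega)), hπ₁ x hx _ (hDV i hi)]
  · refine sub_nonpos.1 (le_of_mem_convexHull hz (Y (e 0) - X v) (c := 0) fun x hx => ?_)
    change x (Sum.inr _) - x (Sum.inl v) ≤ 0
    rw [hze x hx 0 hk]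
    nlinarith [hx₀ x hx v hvV, hπ₁ x hx _ (hpV 0 hk)]
  · refine le_of_mem_convexHull hz (X v + Z ((e 0).erase v) - Y (e 0)) fun x hx => ?_
    change x (Sum.inl v) + zc x _ - x (Sum.inr _) ≤ 1
    rw [hze x hx 0 hk, hzc x hx 0 hk]
    nlinarith [hx₁ x hx v hvV, hπ₁ x hx _ (hpV 0 hk)]
  · refine sub_nonpos.1 (le_of_mem_convexHull hz (Z ((e 0).erase v) - X u)
      (c := 0) fun x hx => ?_)
    change zc x _ - x (Sum.inl u) ≤ 0
    rw [hzc x hx 0 hk]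
    exact sub_nonpos.2 (prod_le_of_mem (fun w hw => hx₀ x hx w (hpV 0 hk hw))
      (fun w hw => hx₁ x hx w (hpV 0 hk hw)) hu)
  · refine le_of_mem_convexHull hz (W ((e 0).erase v) - Z ((e 0).erase v)) fun x hx => ?_
    change ∑ u ∈ _, x (Sum.inl u) - zc x _ ≤ _
    rw [hzc x hx 0 hk]
    have := one_sub_prod_le_sum_one_sub (fun u hu => hx₀ x hx u (hpV 0 hk hu))
      fun u hu => hx₁ x hx u (hpV 0 hk hu)
    rw [Finset.sum_sub_distrib, Finset.sum_const, nsmul_one] at this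
    linarith

open MeasureTheory Set in
theorem pointedPolytope_subset_convexHull_mSet {V : Finset α} {E : Finset (Finset α)}
    {v : α} {k : ℕ} (hk : 1 ≤ k) {e : ℕ → Finset α} (hE : ∀ f ∈ E, f ⊆ V)
    (hchain : ∀ i, i + 1 < k → e i ⊂ e (i + 1)) (hv : ∀ i < k, v ∈ e i)
    (hcard : ∀ i < k, 2 ≤ (e i).card) (hV : V = e (k - 1))
    (hEe : ∀ f ∈ E, ∃ i < k, f = e i ∨ f = (e i).erase v ∧ 2 ≤ f.card) :
    pointedPolytope V E v k e ⊆ convexHull ℝ (mSet V E) := by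
  rintro z ⟨hV₀, hE₀, hle, hlast, hlast', hb, hab, hau, hsum, hbv, hav, hau₀, hsum₀⟩
  obtain ⟨n, rfl⟩ : ∃ n, k = n + 1 := ⟨k - 1, by omega⟩
  rw [Nat.add_sub_cancel] at hV hlast hlast'
  set w := z (Sum.inl v)
  set a : ℕ → ℝ := fun i => zc z ((e i).erase v)
  set b : ℕ → ℝ := fun i => z (Sum.inr (e i))
  have hb₀ : ∀ i ≤ n, 0 ≤ b i ∧ 0 ≤ a i - b i := by
    intro i hi
    induction hi using Nat.decreasingInduction with
    | self => exact ⟨hlast, sub_nonneg.2 hlast'⟩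
    | of_succ i hi ih =>
      have h₁ : b (i + 1) ≤ b i := hb i (by omega)
      have h₂ : -a i + a (i + 1) + b i - b (i + 1) ≤ 0 := hab i (by omega)
      exact ⟨by linarith, by linarith⟩
  have hb₁ : ∀ i ≤ n, b i ≤ w ∧ a i - b i ≤ 1 - w := by
    intro i hi
    induction i with
    | zero =>
      have h₁ : w + a 0 - b 0 ≤ 1 := hav
      exact ⟨hbv, by linarith⟩
    | succ i ih =>
      have h₁ : b (i + 1) ≤ b i := hb i (by omega)
      have h₂ : -a i + a (i + 1) + b i - b (i + 1) ≤ 0 := hab i (by omega)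
      have := ih (by omega)
      exact ⟨by linarith, by linarith⟩
  have hvV : v ∈ V := hV ▸ hv n (by omega)
  have hw₁ : w ≤ 1 := hle v hvV
  have hw₀ : 0 ≤ w := (hb₀ 0 (by omega)).1.trans hbv
  let P : ℕ → Finset α := fun i => Nat.casesOn i ∅ fun i => (e i).erase v
  let A : ℕ → Set ℝ := fun i => Nat.casesOn i (Ico (w - 1) w) fun i => Ico (-(a i - b i)) (b i)
  have hvolΩ : volume.real (Ico (w - 1) w) = 1 := by
    rw [Real.volume_real_Ico_of_le (by linarith)]
    ring
  have hvolA : ∀ i ≤ n, volume.real (A (i + 1)) = a i := by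
    intro i hi
    have := hb₀ i hi
    change volume.real (Ico (-(a i - b i)) (b i)) = a i
    rw [Real.volume_real_Ico_of_le (by linarith)]
    ring
  have hAΩ : ∀ i ≤ n, A (i + 1) ⊆ Ico (w - 1) w := fun i hi =>
    Ico_subset_Ico (by linarith [(hb₁ i hi).2]) (hb₁ i hi).1
  have hPV : ∀ i ≤ n, (e i).erase v ⊆ (e n).erase v := by
    suffices ∀ m ≤ n, ∀ i ≤ m, e i ⊆ e m from
      fun i hi => Finset.erase_subset_erase v (this n le_rfl i hi)
    intro m hm i hi
    induction m, hi using Nat.le_induction with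
    | base => rfl
    | succ m _ ih => exact (ih (by omega)).trans (hchain m (by omega)).1
  have hsdiff : ∀ i, i + 1 ≤ n → P (i + 2) \ P (i + 1) = e (i + 1) \ e i := fun i hi =>
    erase_sdiff_erase_of_mem (hv i (by omega))
  obtain ⟨C, hC, hCA⟩ := exists_events_of_chain (p := w - 1) (q := w) (by ring)
    (fun u => z (Sum.inl u)) P A (n + 1) rfl rfl
    (fun i _ => by cases i <;> exact measurableSet_Ico)
    (fun i hi => by
      cases i with
      | zero =>
        refine Finset.empty_ssubset.2 (Finset.card_pos.1 ?_)
        have := hcard 0 (by omega)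
        rw [Finset.card_erase_of_mem (hv 0 (by omega))]
        omega
      | succ i =>
        refine ⟨Finset.erase_subset_erase v (hchain i hi).1, fun h =>
          (hchain i hi).2 fun u hu => ?_⟩
        by_cases huv : u = v
        · exact huv ▸ hv i (by omega)
        · exact Finset.mem_of_mem_erase (h (Finset.mem_erase.2 ⟨huv, hu⟩)))
    (fun i hi => by
      cases i with
      | zero => exact hAΩ 0 (by omega)
      | succ i =>
        have h₁ : b (i + 1) ≤ b i := hb i (by omega)
        have h₂ : -a i + a (i + 1) + b i - b (i + 1) ≤ 0 := hab i (by omega)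
        exact Ico_subset_Ico (by linarith) h₁)
    (fun i hi u hu => hle u (hV ▸ Finset.mem_of_mem_erase (hPV i (by omega) hu)))
    (fun i hi u hu => by
      rw [hvolA i (by omega)]
      cases i with
      | zero => exact hau₀ u (Finset.mem_sdiff.1 hu).1
      | succ i => exact hau i hi u (by rwa [hsdiff i (by omega)] at hu))
    (fun i hi => by
      rw [hvolA i (by omega), Finset.sum_sub_distrib, Finset.sum_const, nsmul_one]
      cases i with
      | zero =>
        change volume.real (Ico (w - 1) w) - a 0 ≤
          ((((e 0).erase v \ ∅).card : ℕ) : ℝ) - ∑ u ∈ (e 0).erase v \ ∅, z (Sum.inl u)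
        rw [hvolΩ, Finset.sdiff_empty]
        have h : ∑ u ∈ (e 0).erase v, z (Sum.inl u) - a 0 ≤ _ := hsum₀
        linarith
      | succ i =>
        rw [hvolA i (by omega), hsdiff i (by omega)]
        have h : ∑ u ∈ e (i + 1) \ e i, z (Sum.inl u) + a i - a (i + 1) ≤ _ := hsum i hi
        linarith)
  have : IsProbabilityMeasure (volume.restrict (Ico (w - 1) w)) :=
    ⟨by rw [Measure.restrict_apply_univ, Real.volume_Ico]; simp⟩
  have hBΩ : Ico 0 w ⊆ Ico (w - 1) w := Ico_subset_Ico_left (by linarith)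
  let C' : α → Set ℝ := fun u => if u = v then Ico 0 w else C u
  have hC'v : C' v = Ico 0 w := if_pos rfl
  have hC' : ∀ u ≠ v, C' u = C u := fun u hu => if_neg hu
  have hreal : ∀ s, (volume.restrict (Ico (w - 1) w)).real s =
      volume.real (s ∩ Ico (w - 1) w) := fun s => by
    rw [measureReal_restrict_apply' measurableSet_Ico]
  have hCV : ∀ u ∈ V, u ≠ v → u ∈ P (n + 1) := fun u hu huv =>
    Finset.mem_erase.2 ⟨huv, hV ▸ hu⟩
  have hinter : ∀ i ≤ n, ∀ ω ∈ Ico (w - 1) w, ω ∈ A (i + 1) ↔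
      ω ∈ ⋂ u ∈ (e i).erase v, C' u := by
    intro i hi ω hω
    rw [hCA (i + 1) (by omega) ω hω, mem_iInter₂]
    exact forall₂_congr fun u hu => by rw [hC' u (Finset.ne_of_mem_erase hu)]
  refine mem_convexHull_mSet_of_measure (volume.restrict (Ico (w - 1) w)) hE C'
    (fun u hu => ?_) z hV₀ hE₀ (fun u hu => ?_) fun f hf => ?_
  · by_cases huv : u = v
    · rw [huv, hC'v]
      exact measurableSet_Ico
    · rw [hC' u huv]
      exact (hC u (hCV u hu huv)).1
  · rw [hreal]
    by_cases huv : u = v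
    · rw [huv, hC'v, inter_eq_left.2 hBΩ, Real.volume_real_Ico_of_le hw₀, sub_zero]
    · obtain ⟨-, h₁, h₂⟩ := hC u (hCV u hu huv)
      rw [hC' u huv, inter_eq_left.2 h₁, h₂]
  · rw [hreal]
    obtain ⟨i, hi, rfl | ⟨rfl, hf₂⟩⟩ := hEe f hf
    · have : (⋂ u ∈ e i, C' u) ∩ Ico (w - 1) w = Ico 0 (b i) := by
        obtain ⟨h₁, h₂⟩ := hb₀ i (by omega)
        ext ω
        rw [← Finset.insert_erase (hv i hi), Finset.set_biInter_insert, hC'v]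
        constructor
        · rintro ⟨⟨h, hωC⟩, hω⟩
          exact ⟨h.1, ((hinter i (by omega) ω hω).2 hωC).2⟩
        · rintro ⟨h, h'⟩
          have hωB : ω ∈ Ico 0 w := ⟨h, h'.trans_le (hb₁ i (by omega)).1⟩
          exact ⟨⟨hωB, (hinter i (by omega) ω (hBΩ hωB)).1 ⟨by linarith, h'⟩⟩, hBΩ hωB⟩
      rw [this, Real.volume_real_Ico_of_le (hb₀ i (by omega)).1, sub_zero]
    · have : (⋂ u ∈ (e i).erase v, C' u) ∩ Ico (w - 1) w = A (i + 1) := by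
        ext ω
        exact ⟨fun h => (hinter i (by omega) ω h.2).2 h.1, fun h =>
          ⟨(hinter i (by omega) ω (hAΩ i (by omega) h)).1 h, hAΩ i (by omega) h⟩⟩
      rw [this, hvolA i (by omega)]
      exact (if_pos hf₂).symm

/-- the multilinear polytope of a hypergraph pointed at `v`. -/
theorem pointed_multilinear_polytope
    (V : Finset α) (E : Finset (Finset α)) (hG : IsHypergraph V E)
    (v : α) (k : ℕ) (hk : 1 ≤ k) (e : Fin k → Finset α)
    (hchain : ∀ i j : Fin k, i < j → e i ⊂ e j)
    (hEv : ∀ f : Finset α, (f ∈ E ∧ v ∈ f) ↔ ∃ i, f = e i)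
    (hV : V = e ⟨k - 1, by omega⟩)
    (hE : E = Finset.univ.image e ∪
        (Finset.univ.image fun i => (e i).erase v).filter fun p => 2 ≤ p.card) :
    convexHull ℝ (mSet V E) =
      { z | (∀ u, u ∉ V → z (Sum.inl u) = 0)
          ∧ (∀ f, f ∉ E → z (Sum.inr f) = 0)
          ∧ (∀ u ∈ V, z (Sum.inl u) ≤ 1)
          ∧ 0 ≤ z (Sum.inr (e ⟨k - 1, by omega⟩))
          ∧ z (Sum.inr (e ⟨k - 1, by omega⟩)) ≤ zc z ((e ⟨k - 1, by omega⟩).erase v)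
          ∧ (∀ i : ℕ, ∀ h : i + 1 < k,
              z (Sum.inr (e ⟨i + 1, h⟩)) ≤ z (Sum.inr (e ⟨i, by omega⟩)))
          ∧ (∀ i : ℕ, ∀ h : i + 1 < k,
              - zc z ((e ⟨i, by omega⟩).erase v) + zc z ((e ⟨i + 1, h⟩).erase v)
                + z (Sum.inr (e ⟨i, by omega⟩)) - z (Sum.inr (e ⟨i + 1, h⟩)) ≤ 0)
          ∧ (∀ i : ℕ, ∀ h : i + 1 < k, ∀ u ∈ e ⟨i + 1, h⟩ \ e ⟨i, by omega⟩,
              zc z ((e ⟨i + 1, h⟩).erase v) ≤ z (Sum.inl u))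
          ∧ (∀ i : ℕ, ∀ h : i + 1 < k,
              (∑ u ∈ e ⟨i + 1, h⟩ \ e ⟨i, by omega⟩, z (Sum.inl u))
                + zc z ((e ⟨i, by omega⟩).erase v) - zc z ((e ⟨i + 1, h⟩).erase v)
                ≤ ((e ⟨i + 1, h⟩ \ e ⟨i, by omega⟩).card : ℝ))
          ∧ z (Sum.inr (e ⟨0, by omega⟩)) ≤ z (Sum.inl v)
          ∧ z (Sum.inl v) + zc z ((e ⟨0, by omega⟩).erase v)
              - z (Sum.inr (e ⟨0, by omega⟩)) ≤ 1
          ∧ (∀ u ∈ (e ⟨0, by omega⟩).erase v,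
              zc z ((e ⟨0, by omega⟩).erase v) ≤ z (Sum.inl u))
          ∧ (∑ u ∈ (e ⟨0, by omega⟩).erase v, z (Sum.inl u))
              - zc z ((e ⟨0, by omega⟩).erase v)
              ≤ (((e ⟨0, by omega⟩).erase v).card : ℝ) - 1 } := by
  obtain ⟨e', he⟩ : ∃ e' : ℕ → Finset α, ∀ i (h : i < k), e ⟨i, h⟩ = e' i :=
    ⟨fun i => if h : i < k then e ⟨i, h⟩ else ∅, fun i h => by simp [h]⟩
  have hmem : ∀ i < k, e' i ∈ E ∧ v ∈ e' i := fun i hi => (hEv _).2 ⟨⟨i, hi⟩, (he i hi).symm⟩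
  have hchain' : ∀ i, i + 1 < k → e' i ⊂ e' (i + 1) := fun i hi => by
    rw [← he i (by omega), ← he _ hi]
    exact hchain ⟨i, by omega⟩ ⟨i + 1, hi⟩ (Fin.mk_lt_mk.2 (Nat.lt_succ_self i))
  have hpE : ∀ i < k, 2 ≤ ((e' i).erase v).card → (e' i).erase v ∈ E := fun i hi h => by
    rw [hE]
    refine Finset.mem_union_right _ (Finset.mem_filter.2 ⟨Finset.mem_image.2
      ⟨⟨i, hi⟩, Finset.mem_univ _, by rw [he]⟩, h⟩)
  have hEe : ∀ f ∈ E, ∃ i < k, f = e' i ∨ f = (e' i).erase v ∧ 2 ≤ f.card := by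
    intro f hf
    rw [hE, Finset.mem_union, Finset.mem_filter, Finset.mem_image, Finset.mem_image] at hf
    rcases hf with ⟨⟨i, hi⟩, -, rfl⟩ | ⟨⟨⟨i, hi⟩, -, rfl⟩, h⟩
    · exact ⟨i, hi, Or.inl (he i hi)⟩
    · exact ⟨i, hi, Or.inr ⟨by rw [he], h⟩⟩
  simp only [he] at hV ⊢
  exact Set.Subset.antisymm
    (convexHull_mSet_subset_pointedPolytope hk hG.1 hchain' (fun i hi => (hmem i hi).2)
      (fun i hi => hG.2 _ (hmem i hi).1) (fun i hi => (hmem i hi).1) hpE)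
    (pointedPolytope_subset_convexHull_mSet hk hG.1 hchain' (fun i hi => (hmem i hi).2)
      (fun i hi => hG.2 _ (hmem i hi).1) hV hEe)
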